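/- arXiv:0811.1209 — 5 statements merged into one kernel-verified Lean document; each statement's English description precedes it below -/
import Mathlib

section
/- Let N ≥ 1, let ψ be a vector in ℂ^N, let ρ be any N×N complex matrix, and let U_0, …, U_{N-1} be unitary N×N matrices. Define the SWAP matrix S and the controlled unitary CU on the index set Fin N × Fin N as in the context, and set V = CU * S. Then the partial trace over the first tensor factor of V * (|ψ⟩⟨ψ| ⊗ ρ) * V† equals Σ_{k=0}^{N-1} ρ_{kk} • |U_k ψ⟩⟨U_k ψ|. In particular, the Deutsch self-consistency condition ρ = Tr₁[V (|ψ⟩⟨ψ| ⊗ ρ) V†] is equivalent to the entrywise equation ρ_{mn} = Σ_k ρ_{kk} (U_k ψ)_m conj((U_k ψ)_n). -/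
open Matrix Kronecker
open scoped ComplexConjugate

noncomputable section

/-- The outer product `|φ⟩⟨χ|`. -/
def outer {ι : Type*} (φ χ : ι → ℂ) : Matrix ι ι ℂ :=
  Matrix.of fun m n => φ m * conj (χ n)

/-- Partial trace over the first tensor factor. -/
def ptrace1 {d N : ℕ} (M : Matrix (Fin d × Fin N) (Fin d × Fin N) ℂ) :
    Matrix (Fin N) (Fin N) ℂ :=
  Matrix.of fun m n => ∑ s : Fin d, M (s, m) (s, n)

/-- The SWAP matrix on `ℂ^N ⊗ ℂ^N`. -/
def swapMat (N : ℕ) : Matrix (Fin N × Fin N) (Fin N × Fin N) ℂ :=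
  Matrix.of fun p q => if p.1 = q.2 ∧ p.2 = q.1 then 1 else 0

/-- The controlled unitary `Σ_k |k⟩⟨k| ⊗ U_k` (control on the first factor). -/
def ctrlU {N : ℕ} (U : Fin N → Matrix (Fin N) (Fin N) ℂ) :
    Matrix (Fin N × Fin N) (Fin N × Fin N) ℂ :=
  Matrix.of fun p q => if p.1 = q.1 then U p.1 p.2 q.2 else 0

/-- The entries of `V = CU * S`. -/
lemma ctrlU_mul_swapMat_apply {N : ℕ} (U : Fin N → Matrix (Fin N) (Fin N) ℂ)
    (a b c d : Fin N) :
    (ctrlU U * swapMat N) (a, b) (c, d) = if a = d then U a b c else 0 := by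
  simp [ctrlU, swapMat, Matrix.mul_apply, Fintype.sum_prod_type, ite_and]

/-- The block of `V (|ψ⟩⟨ψ| ⊗ ρ) V†` that is diagonal in the first factor. -/
lemma conj_ctrlU_mul_swapMat_apply {N : ℕ} (ψ : Fin N → ℂ) (ρ : Matrix (Fin N) (Fin N) ℂ)
    (U : Fin N → Matrix (Fin N) (Fin N) ℂ) (s m n : Fin N) :
    ((ctrlU U * swapMat N) * (outer ψ ψ ⊗ₖ ρ) * (ctrlU U * swapMat N)ᴴ) (s, m) (s, n) =
      ρ s s * ((U s).mulVec ψ m * conj ((U s).mulVec ψ n)) := by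
  rw [Matrix.mul_apply, Fintype.sum_prod_type]
  simp only [Matrix.mul_apply (M := ctrlU U * swapMat N), Fintype.sum_prod_type,
    ctrlU_mul_swapMat_apply, Matrix.conjTranspose_apply, Matrix.kroneckerMap_apply, outer,
    Matrix.of_apply, ite_mul, zero_mul, apply_ite (star : ℂ → ℂ), star_zero, mul_ite, mul_zero,
    Finset.sum_ite_eq, Finset.mem_univ, if_true, Matrix.mulVec, dotProduct, map_sum, map_mul,
    Finset.sum_mul, Finset.mul_sum, RCLike.star_def]
  refine Finset.sum_congr rfl fun i _ => Finset.sum_congr rfl fun j _ => ?_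
  ring

/-- With `V = CU * S`, the partial trace over the first factor of
`V (|ψ⟩⟨ψ| ⊗ ρ) V†` equals `Σ_k ρ_{kk} • |U_k ψ⟩⟨U_k ψ|`; in particular Deutsch's
self-consistency condition is equivalent to the entrywise equation. -/
theorem ptrace1_conj_eq
    (N : ℕ) (hN : 1 ≤ N) (ψ : Fin N → ℂ)
    (ρ : Matrix (Fin N) (Fin N) ℂ)
    (U : Fin N → Matrix (Fin N) (Fin N) ℂ)
    (hU : ∀ k, U k ∈ Matrix.unitaryGroup (Fin N) ℂ) :
    (ptrace1 ((ctrlU U * swapMat N) * (outer ψ ψ ⊗ₖ ρ) * (ctrlU U * swapMat N)ᴴ) =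
        ∑ k : Fin N, ρ k k • outer ((U k).mulVec ψ) ((U k).mulVec ψ)) ∧
    ((ρ = ptrace1 ((ctrlU U * swapMat N) * (outer ψ ψ ⊗ₖ ρ) * (ctrlU U * swapMat N)ᴴ)) ↔
      ∀ m n, ρ m n =
        ∑ k : Fin N, ρ k k * ((U k).mulVec ψ m * conj ((U k).mulVec ψ n))) := by
  have h : ptrace1 ((ctrlU U * swapMat N) * (outer ψ ψ ⊗ₖ ρ) * (ctrlU U * swapMat N)ᴴ) =
      ∑ k : Fin N, ρ k k • outer ((U k).mulVec ψ) ((U k).mulVec ψ) := by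
    ext m n
    simp only [ptrace1, Matrix.of_apply, conj_ctrlU_mul_swapMat_apply]
    simp only [Matrix.sum_apply, Matrix.smul_apply, outer, Matrix.of_apply, smul_eq_mul]
  refine ⟨h, ?_⟩
  rw [h, ← Matrix.ext_iff]
  simp only [Matrix.sum_apply, Matrix.smul_apply, outer, Matrix.of_apply, smul_eq_mul]
end
end

section
/- Let ρ be a 2×2 density matrix and let H = (1/√2) • !![1, 1; 1, -1] be the Hadamard matrix. If ρ satisfies ρ = ρ_{00} • |e_0⟩⟨e_0| + ρ_{11} • |H e_0⟩⟨H e_0| (the reduced self-consistency equation for input state |0⟩ with CTC unitaries U_0 = I, U_1 = H), then ρ = |e_0⟩⟨e_0|. -/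
open Matrix
open scoped ComplexConjugate ComplexOrder

noncomputable section

/-- The `j`-th standard basis vector of `ℂ^N`. -/
def stdVec {N : ℕ} (j : Fin N) : Fin N → ℂ := fun i => if i = j then 1 else 0

/-- The Hadamard matrix. -/
def Hmat : Matrix (Fin 2) (Fin 2) ℂ :=
  ((1 / Real.sqrt 2 : ℝ) : ℂ) • !![1, 1; 1, -1]

/-- The `(1, 1)` entry of `|H e₀⟩⟨H e₀|` is `1 / 2`. -/
theorem outer_Hmat_mulVec_stdVec_zero_apply_one_one :
    outer (Hmat.mulVec (stdVec 0)) (Hmat.mulVec (stdVec 0)) 1 1 = 1 / 2 := by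
  have hv : Hmat.mulVec (stdVec 0) 1 = ((1 / Real.sqrt 2 : ℝ) : ℂ) := by
    simp [Hmat, stdVec, Matrix.mulVec, dotProduct]
  have hsq : (1 / Real.sqrt 2) * (1 / Real.sqrt 2) = 1 / 2 := by
    rw [div_mul_div_comm, Real.mul_self_sqrt zero_le_two, one_mul]
  rw [outer, Matrix.of_apply, hv, Complex.conj_ofReal, ← Complex.ofReal_mul, hsq]
  norm_num

/-- A density matrix satisfying the reduced self-consistency equation for input `|0⟩`
(with CTC unitaries `U_0 = I`, `U_1 = H`) must be `|0⟩⟨0|`. -/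
theorem selfConsistent_zero_unique
    (ρ : Matrix (Fin 2) (Fin 2) ℂ)
    (hρ : ρ.PosSemidef) (hρtr : ρ.trace = 1)
    (hsc : ρ = ρ 0 0 • outer (stdVec 0) (stdVec 0) +
        ρ 1 1 • outer (Hmat.mulVec (stdVec 0)) (Hmat.mulVec (stdVec 0))) :
    ρ = outer (stdVec 0) (stdVec 0) := by
  have h11 : ρ 1 1 = 0 := by
    have h := congrFun₂ hsc 1 1
    simp only [Matrix.add_apply, Matrix.smul_apply, smul_eq_mul,
      outer_Hmat_mulVec_stdVec_zero_apply_one_one] at h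
    simp only [outer, stdVec, Matrix.of_apply, one_ne_zero, if_false, zero_mul, mul_zero,
      zero_add] at h
    linear_combination 2 * h
  have h00 : ρ 0 0 = 1 := by
    rw [Matrix.trace_fin_two, h11, add_zero] at hρtr
    exact hρtr
  rw [hsc, h11, h00, one_smul, zero_smul, add_zero]
end
end

section
/- Let ρ be a 2×2 density matrix, let H = (1/√2) • !![1, 1; 1, -1] be the Hadamard matrix, and let ψ = |−⟩ = (e_0 − e_1)/√2. If ρ satisfies ρ = ρ_{00} • |ψ⟩⟨ψ| + ρ_{11} • |H ψ⟩⟨H ψ| (the reduced self-consistency equation for input state |−⟩ with CTC unitaries U_0 = I, U_1 = H), then ρ = |e_1⟩⟨e_1|. -/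
open Matrix
open scoped ComplexConjugate ComplexOrder

noncomputable section

/-- The state `|−⟩ = (|0⟩ − |1⟩)/√2`. -/
def minusVec : Fin 2 → ℂ :=
  ((1 / Real.sqrt 2 : ℝ) : ℂ) • (stdVec 0 - stdVec 1)

/-- The squared amplitude of `|−⟩` is one half. -/
theorem invSqrtTwo_mul_self :
    ((1 / Real.sqrt 2 : ℝ) : ℂ) * ((1 / Real.sqrt 2 : ℝ) : ℂ) = 1 / 2 := by
  rw [← Complex.ofReal_mul, div_mul_div_comm, Real.mul_self_sqrt zero_le_two]
  norm_num

/-- The Hadamard matrix maps `|−⟩` to `|1⟩`. -/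
theorem Hmat_mulVec_minusVec : Hmat.mulVec minusVec = stdVec 1 := by
  unfold Hmat minusVec
  rw [Matrix.smul_mulVec, Matrix.mulVec_smul, smul_smul, invSqrtTwo_mul_self]
  ext i
  fin_cases i <;> norm_num [Matrix.mulVec, dotProduct, Fin.sum_univ_two, stdVec]

/-- The upper-left entry of `|−⟩⟨−|` is one half. -/
theorem outer_minusVec_zero_zero : outer minusVec minusVec 0 0 = 1 / 2 := by
  have h : minusVec 0 = ((1 / Real.sqrt 2 : ℝ) : ℂ) := by simp [minusVec, stdVec]
  rw [outer, Matrix.of_apply, h, Complex.conj_ofReal, invSqrtTwo_mul_self]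

/-- A density matrix satisfying the reduced self-consistency equation for input `|−⟩`
(with CTC unitaries `U_0 = I`, `U_1 = H`) must be `|1⟩⟨1|`. -/
theorem selfConsistent_minus_unique
    (ρ : Matrix (Fin 2) (Fin 2) ℂ)
    (hρ : ρ.PosSemidef) (hρtr : ρ.trace = 1)
    (hsc : ρ = ρ 0 0 • outer minusVec minusVec +
        ρ 1 1 • outer (Hmat.mulVec minusVec) (Hmat.mulVec minusVec)) :
    ρ = outer (stdVec 1) (stdVec 1) := by
  rw [Hmat_mulVec_minusVec] at hsc
  have h00 : ρ 0 0 = 0 := by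
    have h := congrFun (congrFun hsc 0) 0
    rw [Matrix.add_apply, Matrix.smul_apply, Matrix.smul_apply, outer_minusVec_zero_zero] at h
    simp only [outer, stdVec, Matrix.of_apply, smul_eq_mul, zero_ne_one, if_false, zero_mul,
      mul_zero, add_zero] at h
    linear_combination 2 * h
  have h11 : ρ 1 1 = 1 := by
    rwa [Matrix.trace_fin_two, h00, zero_add] at hρtr
  rwa [h00, h11, zero_smul, one_smul, zero_add] at hsc
end
end

section
/- Define the 4×4 matrices (indexed by Fin 2 × Fin 2): U_{00} = SWAP, U_{01} = X ⊗ X, U_{10} = (X ⊗ I) * (H ⊗ I), and U_{11} = (X ⊗ H) * SWAP, and the input vectors φ_{00} = e_0 ⊗ e_0, φ_{01} = e_1 ⊗ e_0, φ_{10} = |+⟩ ⊗ e_0, φ_{11} = |−⟩ ⊗ e_0, and target vectors t_{ab} = e_a ⊗ e_b. Then for every (a,b) ∈ Fin 2 × Fin 2, any 4×4 density matrix ρ satisfying the reduced self-consistency equation ρ = Σ_{k ∈ Fin 2 × Fin 2} ρ_{kk} • |U_k φ_{ab}⟩⟨U_k φ_{ab}| must equal |t_{ab}⟩⟨t_{ab}|;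 i.e., the self-consistent CTC state for each BB84 input is unique and equals the computational basis state |ab⟩⟨ab|. -/
open Matrix Kronecker
open scoped ComplexConjugate ComplexOrder

noncomputable section

/-- The state `|+⟩ = (|0⟩ + |1⟩)/√2`. -/
def plusVec : Fin 2 → ℂ :=
  ((1 / Real.sqrt 2 : ℝ) : ℂ) • (stdVec 0 + stdVec 1)

/-- The Pauli X matrix. -/
def Xmat : Matrix (Fin 2) (Fin 2) ℂ := !![0, 1; 1, 0]

/-- The SWAP matrix on `ℂ² ⊗ ℂ²`. -/
def swap4 : Matrix (Fin 2 × Fin 2) (Fin 2 × Fin 2) ℂ :=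
  Matrix.of fun p q => if p.1 = q.2 ∧ p.2 = q.1 then 1 else 0

/-- Tensor product of vectors: `(u ⊗ v)_{(a,b)} = u a * v b`. -/
def vkron (u v : Fin 2 → ℂ) : Fin 2 × Fin 2 → ℂ := fun p => u p.1 * v p.2

/-- The family `U_{00} = SWAP`, `U_{01} = X ⊗ X`, `U_{10} = (X ⊗ I)(H ⊗ I)`,
`U_{11} = (X ⊗ H) SWAP`. -/
def Ufam : Fin 2 × Fin 2 → Matrix (Fin 2 × Fin 2) (Fin 2 × Fin 2) ℂ :=
  fun ab =>
    ![![swap4, Xmat ⊗ₖ Xmat],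
      ![(Xmat ⊗ₖ (1 : Matrix (Fin 2) (Fin 2) ℂ)) * (Hmat ⊗ₖ (1 : Matrix (Fin 2) (Fin 2) ℂ)),
        (Xmat ⊗ₖ Hmat) * swap4]] ab.1 ab.2

/-- The BB84 input states (with appended ancilla `|0⟩`):
`φ_{00} = |00⟩`, `φ_{01} = |10⟩`, `φ_{10} = |+0⟩`, `φ_{11} = |−0⟩`. -/
def φfam : Fin 2 × Fin 2 → (Fin 2 × Fin 2 → ℂ) :=
  fun ab =>
    ![![vkron (stdVec 0) (stdVec 0), vkron (stdVec 1) (stdVec 0)],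
      ![vkron plusVec (stdVec 0), vkron minusVec (stdVec 0)]] ab.1 ab.2

/-- The target computational basis vectors `t_{ab} = e_a ⊗ e_b`. -/
def tfam : Fin 2 × Fin 2 → (Fin 2 × Fin 2 → ℂ) :=
  fun ab => vkron (stdVec ab.1) (stdVec ab.2)

/-- If a self-consistent matrix of unit trace has all its diagonal weight at `j`, it is the pure
state of the `j`-th vector. -/
lemma eq_outer_of_diag_eq_zero {ι : Type*} [Fintype ι] {ρ : Matrix ι ι ℂ}
    {v : ι → ι → ℂ} (htr : ρ.trace = 1) (hρ : ρ = ∑ k, ρ k k • outer (v k) (v k)) (j : ι)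
    (hj : ∀ k, k ≠ j → ρ k k = 0) : ρ = outer (v j) (v j) := by
  have hone : ρ j j = 1 := by
    rw [← htr]
    exact (Finset.sum_eq_single j (fun k _ hk => hj k hk) (by simp)).symm
  rw [hρ, Finset.sum_eq_single j (fun k _ hk => by rw [hj k hk, zero_smul]) (by simp), hone,
    one_smul]

lemma inv_sqrt_two_mul_self : ((√2 : ℝ) : ℂ)⁻¹ * ((√2 : ℝ) : ℂ)⁻¹ = 1 / 2 := by
  rw [← mul_inv, ← Complex.ofReal_mul, Real.mul_self_sqrt zero_le_two]
  norm_num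

lemma Ufam_mulVec_φfam (ab : Fin 2 × Fin 2) : (Ufam ab).mulVec (φfam ab) = tfam ab := by
  have hs := inv_sqrt_two_mul_self
  obtain ⟨a, b⟩ := ab
  funext ⟨c, d⟩
  fin_cases a <;> fin_cases b <;> fin_cases c <;> fin_cases d <;>
    simp [Ufam, φfam, tfam, vkron, stdVec, plusVec, minusVec, Xmat, Hmat, swap4, Matrix.mulVec,
      dotProduct, Matrix.mul_apply, Fintype.sum_prod_type, hs] <;> norm_num

/-- The diagonal of a self-consistent matrix is stationary for the induced classical chain. -/
lemma diag_eq_sum {ι : Type*} [Fintype ι] {ρ : Matrix ι ι ℂ} {v : ι → ι → ℂ}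
    (hρ : ρ = ∑ k, ρ k k • outer (v k) (v k)) (m : ι) :
    ρ m m = ∑ k, ρ k k * (v k m * conj (v k m)) := by
  conv_lhs => rw [hρ]
  simp [Matrix.sum_apply, outer]

lemma diag_eq_zero {ab : Fin 2 × Fin 2} {ρ : Matrix (Fin 2 × Fin 2) (Fin 2 × Fin 2) ℂ}
    (hρ : ρ = ∑ k : Fin 2 × Fin 2, ρ k k •
      outer ((Ufam k).mulVec (φfam ab)) ((Ufam k).mulVec (φfam ab)))
    {k : Fin 2 × Fin 2} (hk : k ≠ ab) : ρ k k = 0 := by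
  have hs := inv_sqrt_two_mul_self
  have h00 := diag_eq_sum hρ (0, 0)
  have h01 := diag_eq_sum hρ (0, 1)
  have h10 := diag_eq_sum hρ (1, 0)
  have h11 := diag_eq_sum hρ (1, 1)
  clear hρ
  obtain ⟨a, b⟩ := ab
  obtain ⟨c, d⟩ := k
  fin_cases a <;> fin_cases b <;>
    simp [Ufam, φfam, vkron, stdVec, plusVec, minusVec, Xmat, Hmat, swap4, Matrix.mulVec,
      dotProduct, Matrix.mul_apply, Fintype.sum_prod_type, hs] at h00 h01 h10 h11 <;>
    fin_cases c <;> fin_cases d <;> simp at hk ⊢ <;> grind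

/-- For each BB84 input, the self-consistent CTC state is unique and equals the
computational basis state `|ab⟩⟨ab|`. -/
theorem bb84_selfConsistent_unique :
    ∀ ab : Fin 2 × Fin 2,
      ∀ ρ : Matrix (Fin 2 × Fin 2) (Fin 2 × Fin 2) ℂ,
        ρ.PosSemidef → ρ.trace = 1 →
        ρ = ∑ k : Fin 2 × Fin 2, ρ k k •
            outer ((Ufam k).mulVec (φfam ab)) ((Ufam k).mulVec (φfam ab)) →
        ρ = outer (tfam ab) (tfam ab) := by
  intro ab ρ _ htr hρ
  rw [← Ufam_mulVec_φfam ab]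
  exact eq_outer_of_diag_eq_zero htr hρ ab fun k hk => diag_eq_zero hρ hk
end
end

section
/- (Deutsch's self-consistency existence condition.) Let d, N ≥ 1, let V be a unitary matrix on the index set Fin d × Fin N, and let σ be any d×d density matrix. Then there exists an N×N density matrix ρ satisfying the self-consistency condition ρ = Tr₁[V (σ ⊗ ρ) V†], where Tr₁ denotes the partial trace over the first (d-dimensional) tensor factor. -/
open Matrix Kronecker
open scoped ComplexConjugate ComplexOrder

noncomputable section

open Filter Topology Pointwise MatrixOrder

/-- A continuous linear self-map of a nonempty compact convex set has a fixed point: any limit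
point of its Cesàro averages is fixed. -/
theorem ContinuousLinearMap.exists_fixedPoint_of_mapsTo_compact_convex
    {E : Type*} [AddCommGroup E] [Module ℝ E] [TopologicalSpace E] [IsTopologicalAddGroup E]
    [ContinuousSMul ℝ E] [T2Space E] (T : E →L[ℝ] E) {K : Set E} (hK : IsCompact K)
    (hconv : Convex ℝ K) (hne : K.Nonempty) (hT : Set.MapsTo T K K) :
    ∃ x ∈ K, T x = x := by
  obtain ⟨x₀, hx₀⟩ := hne
  have hiter (k : ℕ) : T^[k] x₀ ∈ K := hT.iterate k hx₀
  let A (n : ℕ) : E := ((n : ℝ) + 1)⁻¹ • ∑ k ∈ Finset.range (n + 1), T^[k] x₀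
  have hA (n : ℕ) : A n ∈ K := by
    simp only [A, Finset.smul_sum]
    refine hconv.sum_mem (fun _ _ => by positivity) ?_ (fun k _ => hiter k)
    simp only [Finset.sum_const, Finset.card_range, nsmul_eq_mul]
    push_cast
    exact mul_inv_cancel₀ (by positivity)
  have hdiff (n : ℕ) : T (A n) - A n = ((n : ℝ) + 1)⁻¹ • (T^[n + 1] x₀ - x₀) := by
    simp only [A, map_smul, map_sum, ← smul_sub, ← Finset.sum_sub_distrib,
      ← Function.iterate_succ_apply']
    rw [Finset.sum_range_sub (fun k => T^[k] x₀)]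
    rfl
  have hinv : Tendsto (fun n : ℕ => ((n : ℝ) + 1)⁻¹) atTop (𝓝 0) := by
    simpa only [one_div] using tendsto_one_div_add_atTop_nhds_zero_nat (𝕜 := ℝ)
  have hzero : Tendsto (fun n => T (A n) - A n) atTop (𝓝 0) := by
    have hbdd : Bornology.IsVonNBounded ℝ (K - K) :=
      (sub_eq_add_neg K K ▸ hK.add hK.neg : IsCompact (K - K)).isVonNBounded ℝ
    simp only [hdiff]
    exact hbdd.smul_tendsto_zero
      (.of_forall fun n => Set.sub_mem_sub (hiter (n + 1)) hx₀) hinv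
  obtain ⟨a, haK, ha⟩ := hK.ultrafilter_le_nhds ((hyperfilter ℕ).map A)
    (le_principal_iff.2 (Eventually.of_forall hA : ∀ᶠ n in (hyperfilter ℕ : Filter ℕ), A n ∈ K))
  have hlim : Tendsto A (hyperfilter ℕ) (𝓝 a) := ha
  refine ⟨a, haK, sub_eq_zero.1 (tendsto_nhds_unique
    (((T.continuous.tendsto a).comp hlim).sub hlim) (hzero.mono_left ?_))⟩
  exact Nat.hyperfilter_le_atTop

/-- The set of density matrices over a finite index type is compact. -/
theorem Matrix.isCompact_setOf_posSemidef_trace_eq_one (n : Type*) [Fintype n] :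
    IsCompact {ρ : Matrix n n ℂ | ρ.PosSemidef ∧ ρ.trace = 1} := by
  classical
  let S : Set (Matrix n n ℂ) := {B | (Bᴴ * B).trace = 1}
  have hS : IsCompact S := by
    have hbox : IsCompact
        (Set.univ.pi fun _ => Set.univ.pi fun _ => Metric.closedBall 0 1 : Set (n → n → ℂ)) :=
      isCompact_univ_pi fun _ => isCompact_univ_pi fun _ => isCompact_closedBall 0 1
    refine IsCompact.of_isClosed_subset (t := S) hbox
      (isClosed_eq (Continuous.matrix_trace (by fun_prop)) continuous_const) fun B hB i _ j _ => ?_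
    have htr : ∑ j, ∑ i, ‖B i j‖ ^ 2 = 1 := by
      have h : (Bᴴ * B).trace = 1 := hB
      simp only [Matrix.trace, Matrix.diag, Matrix.mul_apply, Matrix.conjTranspose_apply,
        RCLike.star_def, Complex.conj_mul'] at h
      exact_mod_cast h
    have hle : ‖B i j‖ ^ 2 ≤ 1 := by
      rw [← htr]
      exact (Finset.single_le_sum (f := fun i => ‖B i j‖ ^ 2) (fun _ _ => by positivity)
        (Finset.mem_univ i)).trans
        (Finset.single_le_sum (f := fun j => ∑ i, ‖B i j‖ ^ 2) (fun _ _ => by positivity)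
          (Finset.mem_univ j))
    simpa using hle
  convert hS.image (f := fun B => Bᴴ * B) (by fun_prop) using 1
  ext ρ
  constructor
  · rintro ⟨hρ, htr⟩
    obtain ⟨B, rfl⟩ := CStarAlgebra.nonneg_iff_eq_star_mul_self.1 hρ.nonneg
    exact ⟨B, htr, rfl⟩
  · rintro ⟨B, hB, rfl⟩
    exact ⟨Matrix.posSemidef_conjTranspose_mul_self B, hB⟩

theorem Matrix.convex_setOf_posSemidef_trace_eq_one (n : Type*) [Fintype n] :
    Convex ℝ {ρ : Matrix n n ℂ | ρ.PosSemidef ∧ ρ.trace = 1} := by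
  rintro A ⟨hA, hAtr⟩ B ⟨hB, hBtr⟩ a b ha hb hab
  refine ⟨(hA.smul ha).add (hB.smul hb), ?_⟩
  rw [Matrix.trace_add, Matrix.trace_smul, Matrix.trace_smul, hAtr, hBtr, ← add_smul, hab,
    one_smul]

theorem ptrace1_posSemidef {d N : ℕ} {M : Matrix (Fin d × Fin N) (Fin d × Fin N) ℂ}
    (hM : M.PosSemidef) : (ptrace1 M).PosSemidef := by
  have h : ptrace1 M = ∑ s : Fin d, M.submatrix (Prod.mk s) (Prod.mk s) := by
    ext m n
    simp [ptrace1, Matrix.sum_apply]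
  rw [h]
  exact Matrix.posSemidef_sum _ fun s _ => hM.submatrix _

theorem trace_ptrace1 {d N : ℕ} (M : Matrix (Fin d × Fin N) (Fin d × Fin N) ℂ) :
    (ptrace1 M).trace = M.trace := by
  simp only [Matrix.trace, Matrix.diag, ptrace1, Matrix.of_apply]
  rw [Fintype.sum_prod_type, Finset.sum_comm]

/-- The map `ρ ↦ Tr₁[V (σ ⊗ ρ) V†]` as a real linear map. -/
def deutschMap {d N : ℕ} (V : Matrix (Fin d × Fin N) (Fin d × Fin N) ℂ)
    (σ : Matrix (Fin d) (Fin d) ℂ) :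
    Matrix (Fin N) (Fin N) ℂ →L[ℝ] Matrix (Fin N) (Fin N) ℂ where
  toFun ρ := ptrace1 (V * (σ ⊗ₖ ρ) * Vᴴ)
  map_add' A B := by
    ext
    simp [ptrace1, Matrix.kronecker_add, Matrix.mul_add, Matrix.add_mul, Finset.sum_add_distrib]
  map_smul' r A := by
    ext
    simp [ptrace1, Matrix.kronecker_smul, Finset.mul_sum]
  cont := by
    refine continuous_matrix fun m n => ?_
    simp only [ptrace1, Matrix.of_apply, Matrix.mul_apply, Matrix.kroneckerMap_apply]
    fun_prop

/-- Deutsch's self-consistency existence condition: for any unitary interaction `V` and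
any input density matrix `σ`, there exists a density matrix `ρ` on the CTC system with
`ρ = Tr₁[V (σ ⊗ ρ) V†]`. -/
theorem deutsch_fixed_point_exists
    (d N : ℕ) (hd : 1 ≤ d) (hN : 1 ≤ N)
    (V : Matrix (Fin d × Fin N) (Fin d × Fin N) ℂ)
    (hV : V ∈ Matrix.unitaryGroup (Fin d × Fin N) ℂ)
    (σ : Matrix (Fin d) (Fin d) ℂ)
    (hσ : σ.PosSemidef) (hσtr : σ.trace = 1) :
    ∃ ρ : Matrix (Fin N) (Fin N) ℂ,
      ρ.PosSemidef ∧ ρ.trace = 1 ∧ ρ = ptrace1 (V * (σ ⊗ₖ ρ) * Vᴴ) := by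
  have hVV : Vᴴ * V = 1 := Matrix.mem_unitaryGroup_iff'.1 hV
  have hne : {ρ : Matrix (Fin N) (Fin N) ℂ | ρ.PosSemidef ∧ ρ.trace = 1}.Nonempty := by
    let i : Fin N := ⟨0, hN⟩
    refine ⟨Matrix.diagonal (Pi.single i 1), ?_, ?_⟩
    · exact Matrix.PosSemidef.diagonal (Pi.single_nonneg.2 zero_le_one)
    · simp [Matrix.trace_diagonal]
  have hmaps : Set.MapsTo (deutschMap V σ)
      {ρ : Matrix (Fin N) (Fin N) ℂ | ρ.PosSemidef ∧ ρ.trace = 1}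
      {ρ : Matrix (Fin N) (Fin N) ℂ | ρ.PosSemidef ∧ ρ.trace = 1} := by
    rintro ρ ⟨hρ, hρtr⟩
    refine ⟨ptrace1_posSemidef ((hσ.kronecker hρ).mul_mul_conjTranspose_same V), ?_⟩
    calc (ptrace1 (V * (σ ⊗ₖ ρ) * Vᴴ)).trace = (Vᴴ * V * (σ ⊗ₖ ρ)).trace := by
          rw [trace_ptrace1, Matrix.trace_mul_comm, Matrix.mul_assoc]
      _ = 1 := by rw [hVV, Matrix.one_mul, Matrix.trace_kronecker, hσtr, hρtr, one_mul]
  obtain ⟨ρ, ⟨hρ, hρtr⟩, hfix⟩ :=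
    (deutschMap V σ).exists_fixedPoint_of_mapsTo_compact_convex
      (Matrix.isCompact_setOf_posSemidef_trace_eq_one (Fin N))
      (Matrix.convex_setOf_posSemidef_trace_eq_one (Fin N)) hne hmaps
  exact ⟨ρ, hρ, hρtr, hfix.symm⟩
end
end
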